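/- arXiv:2009.12397 — 5 statements merged into one kernel-verified Lean document; each statement's English description precedes it below -/
import Mathlib

section
/- Let X and Y be Banach spaces and let A be a closed linear relation from X to Y. Then R(A) is closed in Y if and only if there exists a constant γ > 0 which is a lower bound for A, i.e. dist(y, A(0)) ≥ γ·dist(x, N(A)) for every (x,y) ∈ G(A) (note A(0) and N(A) are closed since A is closed). -/
open Metric Set

/-- The range `R(A)` of a linear relation (given by its graph). -/
def relRan {X Y : Type*} [AddCommGroup X] [Module ℂ X] [AddCommGroup Y] [Module ℂ Y]
    (A : Submodule ℂ (X × Y)) : Set Y := {y | ∃ x, (x, y) ∈ A}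

/-- The null space `N(A)` of a linear relation. -/
def relKer {X Y : Type*} [AddCommGroup X] [Module ℂ X] [AddCommGroup Y] [Module ℂ Y]
    (A : Submodule ℂ (X × Y)) : Set X := {x | (x, (0 : Y)) ∈ A}

/-- The set `A(0)` of a linear relation. -/
def relMul0 {X Y : Type*} [AddCommGroup X] [Module ℂ X] [AddCommGroup Y] [Module ℂ Y]
    (A : Submodule ℂ (X × Y)) : Set Y := {y | ((0 : X), y) ∈ A}

/-- The range of a linear relation as a submodule. -/
def relRanSubmodule {X Y : Type*} [AddCommGroup X] [Module ℂ X] [AddCommGroup Y] [Module ℂ Y]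
    (A : Submodule ℂ (X × Y)) : Submodule ℂ Y := A.map (LinearMap.snd ℂ X Y)

theorem coe_relRanSubmodule {X Y : Type*} [AddCommGroup X] [Module ℂ X] [AddCommGroup Y]
    [Module ℂ Y] (A : Submodule ℂ (X × Y)) : (relRanSubmodule A : Set Y) = relRan A := by
  ext y
  simp [relRanSubmodule, relRan]

theorem exists_preimage_norm_le_of_isClosed_relRan {X Y : Type*} [NormedAddCommGroup X]
    [NormedSpace ℂ X] [CompleteSpace X] [NormedAddCommGroup Y] [NormedSpace ℂ Y] [CompleteSpace Y]
    (A : Submodule ℂ (X × Y)) (hA : IsClosed (A : Set (X × Y))) (hR : IsClosed (relRan A)) :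
    ∃ C : ℝ, 0 < C ∧ ∀ y ∈ relRan A, ∃ x, (x, y) ∈ A ∧ ‖x‖ ≤ C * ‖y‖ := by
  have : CompleteSpace A := hA.completeSpace_coe
  have : CompleteSpace (relRanSubmodule A) := by
    rw [← coe_relRanSubmodule] at hR
    exact hR.completeSpace_coe
  let f : A →L[ℂ] relRanSubmodule A :=
    ((ContinuousLinearMap.snd ℂ X Y).comp A.subtypeL).codRestrict (relRanSubmodule A)
      fun a => Submodule.mem_map_of_mem a.2
  have hf : Function.Surjective f := by
    rintro ⟨y, a, ha, rfl⟩
    exact ⟨⟨a, ha⟩, rfl⟩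
  obtain ⟨C, hC, h⟩ := f.exists_preimage_norm_le hf
  refine ⟨C, hC, fun y hy => ?_⟩
  rw [← coe_relRanSubmodule] at hy
  obtain ⟨⟨⟨x, z⟩, ha⟩, hfa, hle⟩ := h ⟨y, hy⟩
  obtain rfl : z = y := congrArg Subtype.val hfa
  exact ⟨x, ha, (norm_fst_le (x, z)).trans hle⟩

theorem isClosed_relRan_of_exists_preimage_norm_le {X Y : Type*} [NormedAddCommGroup X]
    [NormedSpace ℂ X] [CompleteSpace X] [NormedAddCommGroup Y] [NormedSpace ℂ Y] [CompleteSpace Y]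
    (A : Submodule ℂ (X × Y)) (hA : IsClosed (A : Set (X × Y))) {C : ℝ}
    (h : ∀ y ∈ relRan A, ∃ x, (x, y) ∈ A ∧ ‖x‖ ≤ C * ‖y‖) : IsClosed (relRan A) := by
  have : CompleteSpace A := hA.completeSpace_coe
  let f : NormedAddGroupHom A Y :=
    ((LinearMap.snd ℂ X Y).comp A.subtype).toAddMonoidHom.mkNormedAddGroupHom 1
      fun a => by simpa using norm_snd_le (a : X × Y)
  have hf : f.SurjectiveOnWith (relRanSubmodule A).toAddSubgroup (max C 1) := by
    intro y hy
    obtain ⟨x, hx, hle⟩ := h y (by rw [← coe_relRanSubmodule]; exact hy)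
    refine ⟨⟨(x, y), hx⟩, rfl, norm_prod_le_iff.2 ⟨hle.trans ?_, ?_⟩⟩
    · exact mul_le_mul_of_nonneg_right (le_max_left _ _) (norm_nonneg y)
    · exact le_mul_of_one_le_left (norm_nonneg y) (le_max_right _ _)
  have hcl := controlled_closure_of_complete (by positivity) one_pos hf
  refine isClosed_of_closure_subset fun y hy => ?_
  rw [← coe_relRanSubmodule] at hy
  obtain ⟨⟨⟨x, z⟩, ha⟩, hfa, -⟩ := hcl y hy
  exact ⟨x, (show z = y from hfa) ▸ ha⟩

theorem stmt3 {X Y : Type*} [NormedAddCommGroup X] [NormedSpace ℂ X] [CompleteSpace X]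
    [NormedAddCommGroup Y] [NormedSpace ℂ Y] [CompleteSpace Y]
    (A : Submodule ℂ (X × Y)) (hA : IsClosed (A : Set (X × Y))) :
    IsClosed (relRan A) ↔
      ∃ γ : ℝ, 0 < γ ∧ ∀ x y, (x, y) ∈ A →
        γ * infDist x (relKer A) ≤ infDist y (relMul0 A) := by
  have hN : (relKer A).Nonempty := ⟨0, A.zero_mem⟩
  have hM : (relMul0 A).Nonempty := ⟨0, A.zero_mem⟩
  constructor
  · intro hR
    obtain ⟨C, hC, h⟩ := exists_preimage_norm_le_of_isClosed_relRan A hA hR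
    refine ⟨C⁻¹, inv_pos.2 hC, fun x y hxy => (le_infDist hM).2 fun m hm => ?_⟩
    have hxym : (x, y - m) ∈ A := by simpa using A.sub_mem hxy hm
    obtain ⟨x', hx', hle⟩ := h (y - m) ⟨x, hxym⟩
    have hker : x - x' ∈ relKer A := by simpa [relKer] using A.sub_mem hxym hx'
    have hdist : infDist x (relKer A) ≤ ‖x'‖ := by
      simpa [dist_eq_norm] using infDist_le_dist_of_mem (x := x) hker
    rw [inv_mul_le_iff₀ hC, dist_eq_norm]
    exact hdist.trans hle
  · rintro ⟨γ, hγ, h⟩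
    refine isClosed_relRan_of_exists_preimage_norm_le A hA (C := 2 / γ) ?_
    rintro y ⟨x, hxy⟩
    rcases eq_or_ne y 0 with rfl | hy
    · exact ⟨0, A.zero_mem, by simp⟩
    have hy0 : 0 < ‖y‖ := norm_pos_iff.2 hy
    have hyM : infDist y (relMul0 A) ≤ ‖y‖ := by
      simpa using infDist_le_dist_of_mem (x := y) (show (0 : Y) ∈ relMul0 A from A.zero_mem)
    have hlt : infDist x (relKer A) < 2 / γ * ‖y‖ := by
      rw [div_mul_eq_mul_div, lt_div_iff₀' hγ]
      linarith [h x y hxy]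
    obtain ⟨n, hn, hd⟩ := (infDist_lt_iff hN).1 hlt
    refine ⟨x - n, by simpa using A.sub_mem hxy hn, ?_⟩
    rw [← dist_eq_norm]
    exact hd.le
end

section
/- Let X be a normed linear space, let M and N be closed linear subspaces of X, and let x ∈ X. Then for every ε > 0 there exists x₀ ∈ X with x₀ − x ∈ N such that dist(x₀, M) ≥ (1 − ε)·((1 − δ(M,N))/(1 + δ(M,N)))·‖x₀‖. -/
open Metric Set

/-- The gap `δ(M,N)` between two subspaces of a normed space: the supremum of
`dist(u, N)` over unit vectors `u ∈ M` (equal to `0` when `M = {0}`, since the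
supremum of the empty set of reals is `0`). -/
noncomputable def gapDelta {X : Type*} [NormedAddCommGroup X] (M N : Set X) : ℝ :=
  sSup ((fun u => infDist u N) '' {u | u ∈ M ∧ ‖u‖ = 1})

lemma bddAbove_gapDelta {X : Type*} [NormedAddCommGroup X] [NormedSpace ℂ X]
    (M N : Submodule ℂ X) :
    BddAbove ((fun u => infDist u (N : Set X)) '' {u | u ∈ (M : Set X) ∧ ‖u‖ = 1}) := by
  refine ⟨1, ?_⟩
  rintro _ ⟨u, ⟨_, hu⟩, rfl⟩
  simpa [hu] using infDist_le_dist_of_mem (x := u) N.zero_mem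

lemma gapDelta_nonneg {X : Type*} [NormedAddCommGroup X] (M N : Set X) :
    0 ≤ gapDelta M N := by
  refine Real.sSup_nonneg ?_
  rintro _ ⟨u, _, rfl⟩
  exact infDist_nonneg

lemma gapDelta_le_one {X : Type*} [NormedAddCommGroup X] [NormedSpace ℂ X]
    (M N : Submodule ℂ X) : gapDelta (M : Set X) (N : Set X) ≤ 1 := by
  refine Real.sSup_le ?_ zero_le_one
  rintro _ ⟨u, ⟨_, hu⟩, rfl⟩
  simpa [hu] using infDist_le_dist_of_mem (x := u) N.zero_mem

lemma infDist_le_gapDelta_mul_norm {X : Type*} [NormedAddCommGroup X] [NormedSpace ℂ X]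
    (M N : Submodule ℂ X) {v : X} (hv : v ∈ M) :
    infDist v (N : Set X) ≤ gapDelta (M : Set X) (N : Set X) * ‖v‖ := by
  rcases eq_or_ne v 0 with rfl | hv0
  · simp [infDist_zero_of_mem (s := (N : Set X)) N.zero_mem]
  have hpos : 0 < ‖v‖ := norm_pos_iff.mpr hv0
  set a : ℂ := (‖v‖ : ℂ) with ha
  have ha0 : a ≠ 0 := by simpa [ha] using hv0
  have hna : ‖a‖ = ‖v‖ := by simp [ha]
  have hunit : infDist (a⁻¹ • v) (N : Set X) ≤ gapDelta (M : Set X) (N : Set X) := by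
    refine le_csSup (bddAbove_gapDelta M N) ⟨a⁻¹ • v, ⟨M.smul_mem _ hv, ?_⟩, rfl⟩
    rw [norm_smul, norm_inv, hna, inv_mul_cancel₀ hpos.ne']
  have hscale : infDist v (N : Set X) / ‖v‖ ≤ infDist (a⁻¹ • v) (N : Set X) := by
    refine (le_infDist ⟨0, N.zero_mem⟩).mpr fun {y} hy => ?_
    rw [div_le_iff₀ hpos]
    calc infDist v (N : Set X) ≤ dist v (a • y) := infDist_le_dist_of_mem (N.smul_mem a hy)
      _ = dist (a • a⁻¹ • v) (a • y) := by rw [smul_inv_smul₀ ha0]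
      _ = dist (a⁻¹ • v) y * ‖v‖ := by rw [dist_smul₀, hna, mul_comm]
  exact (div_le_iff₀ hpos).mp (hscale.trans hunit)

lemma infDist_add_mem_le {X : Type*} [NormedAddCommGroup X] [NormedSpace ℂ X]
    (N : Submodule ℂ X) (v : X) {n : X} (hn : n ∈ N) :
    infDist (v + n) (N : Set X) ≤ infDist v (N : Set X) := by
  refine (le_infDist ⟨0, N.zero_mem⟩).mpr fun {y} hy => ?_
  simpa using infDist_le_dist_of_mem (x := v + n) (N.add_mem hy hn)

/-- A coset of a closed subspace contains vectors whose norm is almost their distance to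
the subspace. -/
lemma exists_sub_mem_mul_norm_le_infDist {X : Type*} [NormedAddCommGroup X] [NormedSpace ℂ X]
    (N : Submodule ℂ X) (hN : IsClosed (N : Set X)) (x : X) {c : ℝ} (hc0 : 0 < c) (hc1 : c < 1) :
    ∃ x₀ : X, x₀ - x ∈ N ∧ c * ‖x₀‖ ≤ infDist x₀ (N : Set X) := by
  by_cases hx : x ∈ N
  · exact ⟨0, by simpa using hx, by simpa using infDist_nonneg⟩
  have hd : 0 < infDist x (N : Set X) := (hN.notMem_iff_infDist_pos ⟨0, N.zero_mem⟩).mp hx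
  obtain ⟨n, hn, hlt⟩ := (infDist_lt_iff (s := (N : Set X)) ⟨0, N.zero_mem⟩).mp
    ((lt_div_iff₀ hc0).mpr (mul_lt_of_lt_one_right hd hc1))
  refine ⟨x - n, by simpa using hn, ?_⟩
  rw [lt_div_iff₀ hc0, dist_eq_norm] at hlt
  have := infDist_add_mem_le N (x - n) hn
  rw [sub_add_cancel] at this
  linarith

theorem stmt4 {X : Type*} [NormedAddCommGroup X] [NormedSpace ℂ X]
    (M N : Submodule ℂ X) (hM : IsClosed (M : Set X)) (hN : IsClosed (N : Set X))
    (x : X) :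
    ∀ ε : ℝ, 0 < ε → ∃ x₀ : X, x₀ - x ∈ N ∧
      (1 - ε) * ((1 - gapDelta (M : Set X) (N : Set X)) /
        (1 + gapDelta (M : Set X) (N : Set X))) * ‖x₀‖ ≤ infDist x₀ (M : Set X) := by
  intro ε hε
  have hδ0 := gapDelta_nonneg (M : Set X) (N : Set X)
  have hδ1 := gapDelta_le_one M N
  have hgap := fun v (hv : v ∈ M) => infDist_le_gapDelta_mul_norm M N hv
  set δ := gapDelta (M : Set X) (N : Set X)
  have hδ : 0 < 1 + δ := by linarith
  rcases le_or_gt ((1 - ε) * (1 - δ)) 0 with h | h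
  · refine ⟨x, by simp, le_trans ?_ infDist_nonneg⟩
    rw [← mul_div_assoc]
    exact mul_nonpos_of_nonpos_of_nonneg (div_nonpos_of_nonpos_of_nonneg h hδ.le) (norm_nonneg x)
  have hδlt : δ < 1 := by
    refine lt_of_le_of_ne hδ1 fun he => ?_
    simp [he] at h
  obtain ⟨x₀, hx₀, hle⟩ := exists_sub_mem_mul_norm_le_infDist N hN x
    (c := (1 - ε) * (1 - δ) + δ) (by linarith) (by nlinarith)
  refine ⟨x₀, hx₀, (le_infDist ⟨0, M.zero_mem⟩).mpr fun {v} hv => ?_⟩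
  have hdist : infDist x₀ (N : Set X) ≤ infDist v (N : Set X) + dist x₀ v :=
    infDist_le_infDist_add_dist
  have hnorm : ‖v‖ ≤ ‖x₀‖ + dist x₀ v := by
    rw [dist_eq_norm]
    exact norm_le_norm_add_norm_sub x₀ v
  have hmul := mul_le_mul_of_nonneg_left hnorm hδ0
  rw [← mul_div_assoc, div_mul_eq_mul_div, div_le_iff₀ hδ]
  linarith [hgap v hv]
end

section
/- Let X and Y be Banach spaces and let A be a closed linear relation from X to Y with closed range R(A). Then for every continuous linear functional f′ ∈ X′ that vanishes on N(A), there exists a continuous linear functional g′ ∈ Y′ such that g′(y) = f′(x) for every (x,y) ∈ G(A). -/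
open Set

/-- A continuous linear map vanishing on the kernel of a surjective bounded operator
between Banach spaces factors through that operator. -/
theorem exists_comp_eq_of_surjective {𝕜 E F G : Type*} [NontriviallyNormedField 𝕜]
    [NormedAddCommGroup E] [NormedSpace 𝕜 E] [CompleteSpace E]
    [NormedAddCommGroup F] [NormedSpace 𝕜 F] [CompleteSpace F]
    [NormedAddCommGroup G] [NormedSpace 𝕜 G]
    (T : E →L[𝕜] F) (hT : Function.Surjective T) (φ : E →L[𝕜] G)
    (hφ : ∀ x, T x = 0 → φ x = 0) :
    ∃ ψ : F →L[𝕜] G, ∀ x, ψ (T x) = φ x := by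
  let L : F →ₗ[𝕜] G := (T.toLinearMap.ker.liftQ φ.toLinearMap hφ).comp
    (T.toLinearMap.quotKerEquivOfSurjective hT).symm.toLinearMap
  have hL : ∀ x, L (T x) = φ x := fun x => by
    have h : (T.toLinearMap.quotKerEquivOfSurjective hT).symm (T x)
        = Submodule.Quotient.mk x := (LinearEquiv.symm_apply_eq _).2 rfl
    exact congrArg (T.toLinearMap.ker.liftQ φ.toLinearMap hφ) h
  have hc : Continuous L := (T.isQuotientMap hT).continuous_iff.2 <| by
    convert φ.continuous using 1
    exact funext hL
  exact ⟨⟨L, hc⟩, hL⟩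

/-- A continuous linear functional vanishing on the kernel of a bounded operator with closed range
between Banach spaces lies in the range of the dual operator. -/
theorem exists_dual_comp_eq_of_isClosed_range {𝕜 E F : Type*} [RCLike 𝕜]
    [NormedAddCommGroup E] [NormedSpace 𝕜 E] [CompleteSpace E]
    [NormedAddCommGroup F] [NormedSpace 𝕜 F] [CompleteSpace F]
    (T : E →L[𝕜] F) (hT : IsClosed (range T)) (φ : E →L[𝕜] 𝕜)
    (hφ : ∀ x, T x = 0 → φ x = 0) :
    ∃ ψ : F →L[𝕜] 𝕜, ∀ x, ψ (T x) = φ x := by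
  have hT' : IsClosed (T.toLinearMap.range : Set F) := hT
  have : CompleteSpace T.toLinearMap.range := hT'.completeSpace_coe
  obtain ⟨ψ₀, hψ₀⟩ := exists_comp_eq_of_surjective
    (T.codRestrict T.toLinearMap.range fun x => ⟨x, rfl⟩)
    (fun ⟨_, x, hx⟩ => ⟨x, Subtype.ext hx⟩) φ
    (fun x hx => hφ x (congrArg Subtype.val hx))
  obtain ⟨ψ, hψ, -⟩ := exists_extension_norm_eq T.toLinearMap.range ψ₀
  exact ⟨ψ, fun x => (hψ ⟨T x, x, rfl⟩).trans (hψ₀ x)⟩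

theorem stmt7 {X Y : Type*} [NormedAddCommGroup X] [NormedSpace ℂ X] [CompleteSpace X]
    [NormedAddCommGroup Y] [NormedSpace ℂ Y] [CompleteSpace Y]
    (A : Submodule ℂ (X × Y)) (hA : IsClosed (A : Set (X × Y)))
    (hR : IsClosed (relRan A)) :
    ∀ f' : X →L[ℂ] ℂ, (∀ x ∈ relKer A, f' x = 0) →
      ∃ g' : Y →L[ℂ] ℂ, ∀ x y, (x, y) ∈ A → g' y = f' x := by
  intro f' hf'
  have : CompleteSpace A := hA.completeSpace_coe
  have hran : range ((ContinuousLinearMap.snd ℂ X Y).comp A.subtypeL) = relRan A := by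
    ext y
    simp [relRan]
  obtain ⟨g', hg'⟩ := exists_dual_comp_eq_of_isClosed_range
    ((ContinuousLinearMap.snd ℂ X Y).comp A.subtypeL) (hran ▸ hR)
    (f'.comp ((ContinuousLinearMap.fst ℂ X Y).comp A.subtypeL))
    (fun ⟨⟨x, y⟩, hxy⟩ hy => hf' x (by
      obtain rfl : y = 0 := hy
      exact hxy))
  exact ⟨g', fun x y hxy => hg' ⟨(x, y), hxy⟩⟩
end

section
/- Let X and Y be Banach spaces and let A be a closed linear relation from X to Y. Assume that for every ε > 0 and every closed linear subspace M of X of finite codimension there exists x ∈ M ∩ D(A) with ‖x‖ = 1 and ‖A(x)‖ ≤ ε. Then for every ε > 0 there exists an infinite-dimensional closed linear subspace N_ε contained in D(A) such that ‖A(x)‖ ≤ ε·‖x‖ for every x ∈ N_ε. -/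
open Metric Set

/-- The domain `D(A)` of a linear relation (given by its graph). -/
def relDom {X Y : Type*} [AddCommGroup X] [Module ℂ X] [AddCommGroup Y] [Module ℂ Y]
    (A : Submodule ℂ (X × Y)) : Set X := {x | ∃ y, (x, y) ∈ A}

/-- If `(x, f)` is a normalized triangular system (`f k (x j) = 0` for `k < j`), the coefficients
of a finite linear combination of the `x j` are controlled by its norm. -/
theorem norm_coeff_le_of_triangular {X : Type*} [NormedAddCommGroup X] [NormedSpace ℂ X]
    {x : ℕ → X} {f : ℕ → X →L[ℂ] ℂ} (hf : ∀ k, ‖f k‖ = 1) (hx : ∀ k, ‖x k‖ = 1)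
    (hfx : ∀ k, f k (x k) = 1) (htri : ∀ k j, k < j → f k (x j) = 0) (c : ℕ → ℂ) {n k : ℕ}
    (hk : k < n) : ‖c k‖ ≤ 2 ^ k * ‖∑ j ∈ Finset.range n, c j • x j‖ := by
  induction k using Nat.strong_induction_on with
  | _ k ih =>
    set v := ∑ j ∈ Finset.range n, c j • x j with hv
    have hfv : f k v = ∑ j ∈ Finset.range k, c j * f k (x j) + c k := by
      have : f k v = ∑ j ∈ Finset.range (k + 1), c j * f k (x j) := by
        rw [hv, map_sum]
        simp only [map_smul, smul_eq_mul]
        refine (Finset.sum_subset (Finset.range_subset_range.2 hk) fun j _ hj => ?_).symm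
        rw [htri k j (by simpa using hj), mul_zero]
      rw [this, Finset.sum_range_succ, hfx, mul_one]
    have hfv_le : ‖f k v‖ ≤ ‖v‖ := by simpa [hf k] using (f k).le_opNorm v
    have hsum : ‖∑ j ∈ Finset.range k, c j * f k (x j)‖ ≤ (2 ^ k - 1) * ‖v‖ := by
      have hgeom : ∑ j ∈ Finset.range k, (2 : ℝ) ^ j = 2 ^ k - 1 := by
        rw [geom_sum_eq (by norm_num)]; norm_num
      rw [← hgeom, Finset.sum_mul]
      refine norm_sum_le_of_le _ fun j hj => ?_
      have hj := Finset.mem_range.1 hj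
      have hfxj : ‖f k (x j)‖ ≤ 1 := by simpa [hf k, hx j] using (f k).le_opNorm (x j)
      rw [norm_mul]
      exact (mul_le_of_le_one_right (norm_nonneg _) hfxj).trans (ih j hj (hj.trans hk))
    calc ‖c k‖ = ‖f k v - ∑ j ∈ Finset.range k, c j * f k (x j)‖ := by rw [hfv]; simp
      _ ≤ ‖f k v‖ + ‖∑ j ∈ Finset.range k, c j * f k (x j)‖ := norm_sub_le _ _
      _ ≤ 2 ^ k * ‖v‖ := by linarith

theorem linearIndependent_of_triangular {X : Type*} [NormedAddCommGroup X] [NormedSpace ℂ X]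
    {x : ℕ → X} {f : ℕ → X →L[ℂ] ℂ} (hf : ∀ k, ‖f k‖ = 1) (hx : ∀ k, ‖x k‖ = 1)
    (hfx : ∀ k, f k (x k) = 1) (htri : ∀ k j, k < j → f k (x j) = 0) :
    LinearIndependent ℂ x := by
  rw [linearIndependent_iff]
  intro c hc
  obtain ⟨n, hn⟩ := c.support.exists_nat_subset_range
  rw [Finsupp.linearCombination_apply, Finsupp.sum_of_support_subset c hn _ (by simp)] at hc
  ext k
  by_cases hk : k < n
  · simpa [hc] using norm_coeff_le_of_triangular hf hx hfx htri c hk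
  · exact Finsupp.notMem_support_iff.1 fun h => hk (Finset.mem_range.1 (hn h))

/-- If `y k` decays fast, then `∑ c k • x k ↦ ∑ c k • y k` has norm at most `ε`. -/
theorem norm_snd_le_of_mem_span_of_triangular {X Y : Type*} [NormedAddCommGroup X]
    [NormedSpace ℂ X] [NormedAddCommGroup Y] [NormedSpace ℂ Y]
    {x : ℕ → X} {f : ℕ → X →L[ℂ] ℂ} (hf : ∀ k, ‖f k‖ = 1) (hx : ∀ k, ‖x k‖ = 1)
    (hfx : ∀ k, f k (x k) = 1) (htri : ∀ k j, k < j → f k (x j) = 0) {ε : ℝ} (hε : 0 ≤ ε)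
    {y : ℕ → Y} (hy : ∀ k, ‖y k‖ ≤ ε / 4 ^ (k + 1)) {p : X × Y}
    (hp : p ∈ Submodule.span ℂ (range fun k => (x k, y k))) : ‖p.2‖ ≤ ε * ‖p.1‖ := by
  obtain ⟨c, rfl⟩ := Finsupp.mem_span_range_iff_exists_finsupp.1 hp
  obtain ⟨n, hn⟩ := c.support.exists_nat_subset_range
  rw [Finsupp.sum_of_support_subset c hn _ (by simp)]
  simp only [Prod.fst_sum, Prod.snd_sum, Prod.smul_mk]
  set v := ∑ j ∈ Finset.range n, c j • x j
  have hgeom : ∑ j ∈ Finset.range n, (1 / 2 : ℝ) ^ j ≤ 2 := sum_geometric_two_le n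
  calc ‖∑ j ∈ Finset.range n, c j • y j‖
      ≤ ∑ j ∈ Finset.range n, (1 / 2 : ℝ) ^ j * (ε * ‖v‖ / 4) := by
        refine norm_sum_le_of_le _ fun j hj => ?_
        rw [norm_smul]
        calc ‖c j‖ * ‖y j‖ ≤ (2 ^ j * ‖v‖) * (ε / 4 ^ (j + 1)) := by
              gcongr
              · exact norm_coeff_le_of_triangular hf hx hfx htri c (Finset.mem_range.1 hj)
              · exact hy j
          _ = (1 / 2 : ℝ) ^ j * (ε * ‖v‖ / 4) := by
              have h4 : (4 : ℝ) ^ j = 2 ^ j * 2 ^ j := by rw [← mul_pow]; norm_num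
              rw [pow_succ, h4, one_div, inv_pow]
              field_simp
    _ = (∑ j ∈ Finset.range n, (1 / 2 : ℝ) ^ j) * (ε * ‖v‖ / 4) := by rw [Finset.sum_mul]
    _ ≤ 2 * (ε * ‖v‖ / 4) := by gcongr
    _ ≤ ε * ‖v‖ := by
        have : 0 ≤ ε * ‖v‖ := by positivity
        linarith

/-- A closed subspace of `X × Y` on which the second component is bounded by the first has closed
first projection. -/
theorem isClosed_map_fst_of_norm_snd_le {X Y : Type*} [NormedAddCommGroup X] [NormedSpace ℂ X]
    [CompleteSpace X] [NormedAddCommGroup Y] [NormedSpace ℂ Y] [CompleteSpace Y]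
    {B : Submodule ℂ (X × Y)} (hB : IsClosed (B : Set (X × Y))) {ε : ℝ}
    (hle : ∀ p ∈ B, ‖p.2‖ ≤ ε * ‖p.1‖) :
    IsClosed (B.map (LinearMap.fst ℂ X Y) : Set X) := by
  have : CompleteSpace B := hB.completeSpace_coe
  let g : B →L[ℂ] X := (ContinuousLinearMap.fst ℂ X Y).comp B.subtypeL
  have hg : AntilipschitzWith (max 1 ε).toNNReal g := by
    refine AddMonoidHomClass.antilipschitz_of_bound g fun p => ?_
    have hnn : (0 : ℝ) ≤ max 1 ε := zero_le_one.trans (le_max_left _ _)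
    rw [Real.coe_toNNReal _ hnn]
    change max ‖p.1.1‖ ‖p.1.2‖ ≤ max 1 ε * ‖p.1.1‖
    refine max_le (le_mul_of_one_le_left (norm_nonneg _) (le_max_left _ _)) ?_
    exact (hle p p.2).trans (mul_le_mul_of_nonneg_right (le_max_right _ _) (norm_nonneg _))
  convert hg.isClosed_range g.uniformContinuous using 1
  ext z
  simp [g]

/-- The common kernel of finitely many continuous functionals is closed of finite codimension. -/
theorem exists_isClosed_finiteDimensional_quotient_forall_eq_zero {X : Type*}
    [NormedAddCommGroup X] [NormedSpace ℂ X] {ι : Type*} (s : Finset ι) (f : ι → X →L[ℂ] ℂ) :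
    ∃ M : Submodule ℂ X, IsClosed (M : Set X) ∧ FiniteDimensional ℂ (X ⧸ M) ∧
      ∀ x ∈ M, ∀ i ∈ s, f i x = 0 := by
  let L : X →L[ℂ] (s → ℂ) := ContinuousLinearMap.pi fun i => f i
  refine ⟨LinearMap.ker L.toLinearMap, L.isClosed_ker,
    L.toLinearMap.quotKerEquivRange.symm.finiteDimensional, fun x hx i hi => ?_⟩
  exact congrFun (LinearMap.mem_ker.1 hx) ⟨i, hi⟩

theorem exists_triangular_seq {X Y : Type*} [NormedAddCommGroup X] [NormedSpace ℂ X]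
    [NormedAddCommGroup Y] [NormedSpace ℂ Y] (A : Submodule ℂ (X × Y))
    (h : ∀ ε : ℝ, 0 < ε → ∀ M : Submodule ℂ X, IsClosed (M : Set X) →
      FiniteDimensional ℂ (X ⧸ M) →
      ∃ x y, (x, y) ∈ A ∧ x ∈ M ∧ ‖x‖ = 1 ∧ infDist y (closure (relMul0 A)) ≤ ε)
    {ε : ℝ} (hε : 0 < ε) :
    ∃ (x : ℕ → X) (y : ℕ → Y) (f : ℕ → X →L[ℂ] ℂ), (∀ k, (x k, y k) ∈ A) ∧ (∀ k, ‖f k‖ = 1) ∧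
      (∀ k, ‖x k‖ = 1) ∧ (∀ k, f k (x k) = 1) ∧ (∀ k j, k < j → f k (x j) = 0) ∧
      ∀ k, ‖y k‖ ≤ ε / 4 ^ (k + 1) := by
  classical
  obtain ⟨u, hu, hr⟩ := exists_seq_of_forall_finset_exists
    (fun a : ℕ × X × Y × (X →L[ℂ] ℂ) => (a.2.1, a.2.2.1) ∈ A ∧ ‖a.2.2.2‖ = 1 ∧ ‖a.2.1‖ = 1 ∧
      a.2.2.2 a.2.1 = 1 ∧ ‖a.2.2.1‖ ≤ ε / 4 ^ (a.1 + 1))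
    (fun a b => a.1 < b.1 ∧ a.2.2.2 b.2.1 = 0) (by
      intro s _
      obtain ⟨M, hMc, hMf, hM⟩ :=
        exists_isClosed_finiteDimensional_quotient_forall_eq_zero s fun a => a.2.2.2
      set n := s.sup (fun a => a.1) + 1
      have hδ : 0 < ε / 4 ^ (n + 1) := by positivity
      obtain ⟨x, y, hxy, hxM, hx, hy⟩ := h _ (half_pos hδ) M hMc hMf
      rw [infDist_closure] at hy
      obtain ⟨a, ha, hya⟩ := (infDist_lt_iff (s := relMul0 A) ⟨0, A.zero_mem⟩).1
        (hy.trans_lt (half_lt_self hδ))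
      obtain ⟨f, hf, hfx⟩ := exists_dual_vector ℂ x (by rw [← norm_ne_zero_iff, hx]; simp)
      refine ⟨(n, x, y - a, f), ⟨?_, hf, hx, by simp [hfx, hx], ?_⟩, fun b hb => ⟨?_, hM x hxM b hb⟩⟩
      · simpa using A.sub_mem hxy ha
      · rw [dist_eq_norm] at hya
        exact hya.le
      · exact Nat.lt_succ_of_le (Finset.le_sup (f := fun a => a.1) hb))
  have hmono : StrictMono fun k => (u k).1 := fun i j hij => (hr i j hij).1
  refine ⟨fun k => (u k).2.1, fun k => (u k).2.2.1, fun k => (u k).2.2.2, fun k => (hu k).1,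
    fun k => (hu k).2.1, fun k => (hu k).2.2.1, fun k => (hu k).2.2.2.1,
    fun k j hkj => (hr k j hkj).2, fun k => (hu k).2.2.2.2.trans ?_⟩
  have := hmono.le_apply (x := k)
  gcongr
  norm_num

theorem stmt11 {X Y : Type*} [NormedAddCommGroup X] [NormedSpace ℂ X] [CompleteSpace X]
    [NormedAddCommGroup Y] [NormedSpace ℂ Y] [CompleteSpace Y]
    (A : Submodule ℂ (X × Y)) (hA : IsClosed (A : Set (X × Y)))
    (h : ∀ ε : ℝ, 0 < ε → ∀ M : Submodule ℂ X, IsClosed (M : Set X) →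
      FiniteDimensional ℂ (X ⧸ M) →
      ∃ x y, (x, y) ∈ A ∧ x ∈ M ∧ ‖x‖ = 1 ∧ infDist y (closure (relMul0 A)) ≤ ε) :
    ∀ ε : ℝ, 0 < ε → ∃ N : Submodule ℂ X, IsClosed (N : Set X) ∧
      ¬ FiniteDimensional ℂ ↥N ∧ (N : Set X) ⊆ relDom A ∧
      ∀ x ∈ N, ∀ y, (x, y) ∈ A → infDist y (closure (relMul0 A)) ≤ ε * ‖x‖ := by
  intro ε hε
  obtain ⟨x, y, f, hxy, hf, hx, hfx, htri, hy⟩ := exists_triangular_seq A h hε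
  set S := Submodule.span ℂ (range fun k => (x k, y k))
  have hSA : S.topologicalClosure ≤ A :=
    S.topologicalClosure_minimal (Submodule.span_le.2 (range_subset_iff.2 hxy)) hA
  have hle : ∀ p ∈ S.topologicalClosure, ‖p.2‖ ≤ ε * ‖p.1‖ := by
    have hcl : IsClosed {p : X × Y | ‖p.2‖ ≤ ε * ‖p.1‖} :=
      isClosed_le (by fun_prop) (by fun_prop)
    exact fun p hp => closure_minimal (fun q hq =>
      norm_snd_le_of_mem_span_of_triangular hf hx hfx htri hε.le hy hq) hcl hp
  refine ⟨S.topologicalClosure.map (LinearMap.fst ℂ X Y),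
    isClosed_map_fst_of_norm_snd_le S.isClosed_topologicalClosure hle, fun hfin => ?_, ?_, ?_⟩
  · have hmem : ∀ k, x k ∈ S.topologicalClosure.map (LinearMap.fst ℂ X Y) := fun k =>
      ⟨(x k, y k), S.le_topologicalClosure (Submodule.subset_span ⟨k, rfl⟩), rfl⟩
    have hli : LinearIndependent ℂ
        fun k => (⟨x k, hmem k⟩ : S.topologicalClosure.map (LinearMap.fst ℂ X Y)) :=
      LinearIndependent.of_comp (Submodule.subtype _)
        (linearIndependent_of_triangular hf hx hfx htri)
    exact not_finite_iff_infinite.2 inferInstance hli.finite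
  · rintro _ ⟨p, hp, rfl⟩
    exact ⟨p.2, hSA hp⟩
  · rintro _ ⟨⟨v, w⟩, hp, rfl⟩ z hz
    have hmem : z - w ∈ relMul0 A := by
      simpa [relMul0] using A.sub_mem hz (hSA hp)
    calc infDist z (closure (relMul0 A)) ≤ dist z (z - w) :=
          infDist_le_dist_of_mem (subset_closure hmem)
      _ = ‖w‖ := by simp
      _ ≤ ε * ‖v‖ := hle (v, w) hp
end

section
/- Let X and Y be Banach spaces and let T be a closed linear relation from X to Y whose range R(T) is not closed. Then α′(T) = ∞, i.e. for every ε > 0 there exists an infinite-dimensional closed linear subspace N_ε contained in D(T) such that ‖T(x)‖ ≤ ε·‖x‖ for every x ∈ N_ε. -/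
open Metric Set

lemma isClosed_map_of_norm_le {𝕜 E F : Type*} [NontriviallyNormedField 𝕜]
    [NormedAddCommGroup E] [NormedSpace 𝕜 E] [CompleteSpace E]
    [NormedAddCommGroup F] [NormedSpace 𝕜 F] (f : E →L[𝕜] F) (S : Submodule 𝕜 E)
    (hS : IsClosed (S : Set E)) (K : NNReal) (h : ∀ x ∈ S, ‖x‖ ≤ K * ‖f x‖) :
    IsClosed (S.map (f : E →ₗ[𝕜] F) : Set F) := by
  have : CompleteSpace S := hS.completeSpace_coe
  have ha : AntilipschitzWith K (f.comp S.subtypeL) :=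
    (f.comp S.subtypeL).antilipschitz_of_bound fun x => h x x.2
  have hc := ha.isClosed_range (f.comp S.subtypeL).uniformContinuous
  convert! hc using 1
  ext y
  simp

section

variable {X Y : Type*} [NormedAddCommGroup X] [NormedSpace ℂ X]
  [NormedAddCommGroup Y] [NormedSpace ℂ Y]

/-- A closed relation with non-closed range is not bounded below on any subspace cut out by
finitely many continuous functionals. -/
lemma exists_mem_norm_fst_eq_one_norm_snd_le [CompleteSpace X] [CompleteSpace Y]
    {T : Submodule ℂ (X × Y)} (hT : IsClosed (T : Set (X × Y)))
    (hR : ¬ IsClosed (relRan T)) (s : Finset (StrongDual ℂ X)) {δ : ℝ} (hδ : 0 < δ) :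
    ∃ p ∈ T, ‖p.1‖ = 1 ∧ ‖p.2‖ ≤ δ ∧ ∀ f ∈ s, f p.1 = 0 := by
  by_contra! H
  have : CompleteSpace T := hT.completeSpace_coe
  let φ : T →L[ℂ] (s → ℂ) :=
    ContinuousLinearMap.pi fun f => f.1.comp ((ContinuousLinearMap.fst ℂ X Y).comp T.subtypeL)
  let g : T →L[ℂ] Y := (ContinuousLinearMap.snd ℂ X Y).comp T.subtypeL
  have hφ : ∀ p ∈ φ.ker, ∀ f ∈ s, f p.1.1 = 0 := fun p hp f hf => congrFun hp ⟨f, hf⟩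
  have hmap : IsClosed (φ.ker.map (g : T →ₗ[ℂ] Y) : Set Y) := by
    refine isClosed_map_of_norm_le g _ φ.isClosed_ker (max 1 ⟨δ⁻¹, by positivity⟩) ?_
    rintro ⟨⟨x, y⟩, hp⟩ hker
    have hx : ‖x‖ ≤ δ⁻¹ * ‖y‖ := by
      rcases eq_or_ne x 0 with rfl | hx
      · simpa using by positivity
      have hx' : 0 < ‖x‖ := norm_pos_iff.2 hx
      by_contra! hlt
      obtain ⟨f, hf, hne⟩ := H (((‖x‖⁻¹ : ℝ) : ℂ) • (x, y)) (T.smul_mem _ hp)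
        (by simp [norm_smul, hx'.ne'])
        (by
          rw [Prod.smul_snd, norm_smul, Complex.norm_real, norm_inv, norm_norm,
            inv_mul_le_iff₀ hx']
          rw [inv_mul_lt_iff₀ hδ] at hlt
          linarith)
      apply hne
      simp [hφ _ hker f hf]
    rw [Submodule.coe_norm, Prod.norm_mk]
    change max ‖x‖ ‖y‖ ≤ max 1 δ⁻¹ * ‖y‖
    refine max_le (hx.trans ?_) ?_
    · gcongr
      exact le_max_right _ _
    · exact le_mul_of_one_le_left (norm_nonneg _) (le_max_left _ _)
  have hfg : φ.ker.CoFG := Submodule.range_fg_iff_ker_cofg.1 (Module.Finite.iff_fg.1 inferInstance)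
  refine hR ?_
  convert! LinearMap.isClosed_range_of_isClosed_map_of_finiteDimensional_quotient hmap using 1
  ext y
  simp [relRan, g]

/-- Triangular biorthogonality against contractive functionals controls coefficients. -/
lemma norm_coeff_le_of_triangular_s13 {x : ℕ → X} {f : ℕ → StrongDual ℂ X}
    (hx : ∀ n, ‖x n‖ ≤ 1) (hf : ∀ n, ‖f n‖ ≤ 1) (hfx : ∀ n, f n (x n) = 1)
    (h0 : ∀ m n, m < n → f m (x n) = 0) (c : ℕ →₀ ℂ) (k : ℕ) :
    ‖c k‖ ≤ 2 ^ k * ‖Finsupp.linearCombination ℂ x c‖ := by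
  set z := Finsupp.linearCombination ℂ x c with hz
  have key : ∀ k, ‖c k‖ ≤ ‖z‖ + ∑ i ∈ Finset.range k, ‖c i‖ := by
    intro k
    have hsum : f k z = ∑ i ∈ Finset.range k, c i * f k (x i) + c k := by
      obtain ⟨N, hN⟩ : ∃ N, c.support ⊆ Finset.range N := c.support.exists_nat_subset_range
      have hsub : c.support ⊆ Finset.range (max N (k + 1)) :=
        hN.trans (Finset.range_mono (le_max_left _ _))
      rw [hz, Finsupp.linearCombination_apply, Finsupp.sum_of_support_subset _ hsub _ (by simp),
        map_sum, ← Finset.sum_subset (Finset.range_mono (le_max_right N (k + 1))),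
        Finset.sum_range_succ]
      · simp [hfx]
      · intro i _ hi
        rw [Finset.mem_range, not_lt] at hi
        simp [h0 k i hi]
    have hck : c k = f k z - ∑ i ∈ Finset.range k, c i * f k (x i) := by
      rw [hsum]; ring
    rw [hck]
    refine (norm_sub_le _ _).trans (add_le_add ?_ ((norm_sum_le _ _).trans ?_))
    · simpa using (f k).le_of_opNorm_le (hf k) z
    · refine Finset.sum_le_sum fun i _ => ?_
      have : ‖f k (x i)‖ ≤ 1 := by
        simpa using ((f k).le_of_opNorm_le (hf k) (x i)).trans (by simpa using hx i)
      rw [norm_mul]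
      exact mul_le_of_le_one_right (norm_nonneg _) this
  induction k using Nat.strong_induction_on with
  | _ k ih =>
    calc ‖c k‖ ≤ ‖z‖ + ∑ i ∈ Finset.range k, ‖c i‖ := key k
      _ ≤ ‖z‖ + ∑ i ∈ Finset.range k, 2 ^ i * ‖z‖ := by
        gcongr with i hi
        exact ih i (Finset.mem_range.1 hi)
      _ = 2 ^ k * ‖z‖ := by
        rw [← Finset.sum_mul, geom_sum_eq (by norm_num)]
        ring

lemma exists_triangular_seq_s13 [CompleteSpace X] [CompleteSpace Y]
    {T : Submodule ℂ (X × Y)} (hT : IsClosed (T : Set (X × Y)))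
    (hR : ¬ IsClosed (relRan T)) {ε : ℝ} (hε : 0 < ε) :
    ∃ (p : ℕ → X × Y) (f : ℕ → StrongDual ℂ X), (∀ n, p n ∈ T) ∧ (∀ n, ‖(p n).1‖ = 1) ∧
      (∀ n, ‖(p n).2‖ ≤ ε * (1 / 4) ^ n) ∧ (∀ n, ‖f n‖ ≤ 1) ∧ (∀ n, f n (p n).1 = 1) ∧
      ∀ m n, m < n → f m (p n).1 = 0 := by
  classical
  obtain ⟨u, hu, hu'⟩ := exists_seq_of_forall_finset_exists
    (fun a : ((X × Y) × StrongDual ℂ X) × ℕ => a.1.1 ∈ T ∧ ‖a.1.1.1‖ = 1 ∧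
      ‖a.1.1.2‖ ≤ ε * (1 / 4) ^ a.2 ∧ ‖a.1.2‖ ≤ 1 ∧ a.1.2 a.1.1.1 = 1)
    (fun a b => a.1.2 b.1.1.1 = 0 ∧ a.2 < b.2) (by
      intro s _
      obtain ⟨p, hpT, hp1, hp2, hp0⟩ := exists_mem_norm_fst_eq_one_norm_snd_le hT hR
        (s.image fun a => a.1.2)
        (show 0 < ε * (1 / 4) ^ (s.sup (fun a => a.2) + 1) by positivity)
      obtain ⟨f, hf, hfp⟩ := exists_dual_vector'' ℂ p.1
      refine ⟨((p, f), s.sup (fun a => a.2) + 1), ⟨hpT, hp1, hp2, hf, ?_⟩, fun a ha => ⟨?_, ?_⟩⟩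
      · simp [hfp, hp1]
      · exact hp0 _ (Finset.mem_image_of_mem _ ha)
      · exact Nat.lt_succ_of_le (Finset.le_sup (f := fun a => a.2) ha))
  have hmono : StrictMono fun n => (u n).2 := fun m n h => (hu' m n h).2
  refine ⟨fun n => (u n).1.1, fun n => (u n).1.2, fun n => (hu n).1, fun n => (hu n).2.1,
    fun n => (hu n).2.2.1.trans ?_, fun n => (hu n).2.2.2.1, fun n => (hu n).2.2.2.2,
    fun m n h => (hu' m n h).1⟩
  exact mul_le_mul_of_nonneg_left
    (pow_le_pow_of_le_one (by norm_num) (by norm_num) (hmono.id_le n)) hε.le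

end

theorem stmt13 {X Y : Type*} [NormedAddCommGroup X] [NormedSpace ℂ X] [CompleteSpace X]
    [NormedAddCommGroup Y] [NormedSpace ℂ Y] [CompleteSpace Y]
    (T : Submodule ℂ (X × Y)) (hT : IsClosed (T : Set (X × Y)))
    (hR : ¬ IsClosed (relRan T)) :
    ∀ ε : ℝ, 0 < ε → ∃ N : Submodule ℂ X, IsClosed (N : Set X) ∧
      ¬ FiniteDimensional ℂ ↥N ∧ (N : Set X) ⊆ relDom T ∧
      ∀ x ∈ N, ∀ y, (x, y) ∈ T → infDist y (closure (relMul0 T)) ≤ ε * ‖x‖ := by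
  intro ε hε
  obtain ⟨p, f, hpT, hp1, hp2, hf, hfp, h0⟩ := exists_triangular_seq_s13 hT hR (half_pos hε)
  have hcoeff := norm_coeff_le_of_triangular_s13 (fun n => (hp1 n).le) hf hfp h0
  have hfst (c : ℕ →₀ ℂ) : (Finsupp.linearCombination ℂ p c).1 =
      Finsupp.linearCombination ℂ (fun n => (p n).1) c :=
    Finsupp.apply_linearCombination ℂ (LinearMap.fst ℂ X Y) p c
  have hsnd (c : ℕ →₀ ℂ) : (Finsupp.linearCombination ℂ p c).2 =
      Finsupp.linearCombination ℂ (fun n => (p n).2) c :=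
    Finsupp.apply_linearCombination ℂ (LinearMap.snd ℂ X Y) p c
  let L := (Submodule.span ℂ (range p)).topologicalClosure
  have hLT : L ≤ T := Submodule.topologicalClosure_minimal _
    (Submodule.span_le.2 (range_subset_iff.2 hpT)) hT
  have hspan : ∀ q ∈ Submodule.span ℂ (range p), ‖q.2‖ ≤ ε * ‖q.1‖ := by
    intro q hq
    obtain ⟨c, rfl⟩ := (Finsupp.mem_span_range_iff_exists_finsupp).1 hq
    change ‖(Finsupp.linearCombination ℂ p c).2‖ ≤ ε * ‖(Finsupp.linearCombination ℂ p c).1‖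
    rw [hfst, hsnd]
    set z := Finsupp.linearCombination ℂ (fun n => (p n).1) c
    rw [Finsupp.linearCombination_apply]
    calc ‖∑ i ∈ c.support, c i • (p i).2‖
        ≤ ∑ i ∈ c.support, ε / 2 * ‖z‖ * (1 / 2) ^ i := by
          refine norm_sum_le_of_le _ fun i _ => ?_
          rw [norm_smul]
          calc ‖c i‖ * ‖(p i).2‖ ≤ (2 ^ i * ‖z‖) * (ε / 2 * (1 / 4) ^ i) :=
                mul_le_mul (hcoeff c i) (hp2 i) (norm_nonneg _) (by positivity)
            _ = ε / 2 * ‖z‖ * (2 * (1 / 4)) ^ i := by rw [mul_pow]; ring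
            _ = _ := by norm_num
      _ = ε / 2 * ‖z‖ * ∑ i ∈ c.support, (1 / 2) ^ i := by rw [Finset.mul_sum]
      _ ≤ ε / 2 * ‖z‖ * 2 := by
          gcongr
          exact (summable_geometric_two.sum_le_tsum _ fun i _ => by positivity).trans_eq
            tsum_geometric_two
      _ = ε * ‖z‖ := by ring
  have hL : ∀ q ∈ L, ‖q.2‖ ≤ ε * ‖q.1‖ := fun q hq =>
    closure_minimal (t := {q : X × Y | ‖q.2‖ ≤ ε * ‖q.1‖}) hspan
      (isClosed_le (by fun_prop) (by fun_prop)) hq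
  refine ⟨L.map (ContinuousLinearMap.fst ℂ X Y : X × Y →ₗ[ℂ] X), ?_, ?_, ?_, ?_⟩
  · refine isClosed_map_of_norm_le _ L (Submodule.isClosed_topologicalClosure _)
      (max 1 ⟨ε, hε.le⟩) fun q hq => ?_
    change max ‖q.1‖ ‖q.2‖ ≤ max 1 ε * ‖q.1‖
    refine max_le (le_mul_of_one_le_left (norm_nonneg _) (le_max_left _ _)) ((hL q hq).trans ?_)
    gcongr
    exact le_max_right _ _
  · intro hfin
    have hli : LinearIndependent ℂ fun n => (p n).1 := by
      rw [linearIndependent_iff]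
      intro c hc
      ext k
      simpa [hc] using hcoeff c k
    have hmem : ∀ n, (p n).1 ∈ L.map (ContinuousLinearMap.fst ℂ X Y : X × Y →ₗ[ℂ] X) := fun n =>
      ⟨p n, Submodule.le_topologicalClosure _ (Submodule.subset_span ⟨n, rfl⟩), rfl⟩
    have hli' : LinearIndependent ℂ fun n => (⟨(p n).1, hmem n⟩ :
        L.map (ContinuousLinearMap.fst ℂ X Y : X × Y →ₗ[ℂ] X)) :=
      LinearIndependent.of_comp (Submodule.subtype _) hli
    have := hli'.finite
    exact not_finite ℕ
  · rintro _ ⟨q, hq, rfl⟩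
    exact ⟨q.2, hLT hq⟩
  · rintro _ ⟨q, hq, rfl⟩ y hy
    have hmul : y - q.2 ∈ closure (relMul0 T) := subset_closure (by
      have := T.sub_mem hy (hLT hq)
      simpa [relMul0, Prod.sub_def] using this)
    calc infDist y (closure (relMul0 T)) ≤ dist y (y - q.2) := infDist_le_dist_of_mem hmul
      _ = ‖q.2‖ := by simp
      _ ≤ ε * ‖q.1‖ := hL q hq
end
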